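/- Let $f: \mathbb{Z} \to \mathbb{C}$ be $k$-periodic and odd (i.e., $f(-n) = -f(n)$). Then the series $\sum_{r=1}^{\infty} f(r)/r$ converges and equals $\frac{\pi}{2k} \sum_{r=1}^{k-1} f(r) \cot(\pi r/k)$, which also equals $-\frac{\pi i}{k^2} \sum_{r=1}^{k-1} r \widehat{f}(r)$. -/

import Mathlib

/-- Discrete Fourier transform of a `k`-periodic function `f : ℤ → ℂ`. -/
noncomputable def dft (k : ℕ) (f : ℤ → ℂ) (n : ℤ) : ℂ :=
  ∑ a ∈ Finset.range k, f a * Complex.exp (-(2 * (Real.pi : ℂ) * Complex.I * a * n) / k)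

open Filter Topology Complex in
/-- Partial fractions of the cotangent, in reflected form. -/
theorem tendsto_sum_inv_sub_inv_reflect {x : ℂ} (hx : x ∈ integerComplement) :
    Tendsto (fun M : ℕ => ∑ q ∈ Finset.range M, (1 / ((q : ℂ) + x) - 1 / ((q : ℂ) + 1 - x)))
      atTop (𝓝 (Real.pi * cot (Real.pi * x))) := by
  have key : ∀ M : ℕ, ∑ q ∈ Finset.range M, (1 / ((q : ℂ) + x) - 1 / ((q : ℂ) + 1 - x)) =
      1 / x + ∑ j ∈ Finset.range M, cotTerm x j - 1 / ((M : ℂ) + x) := by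
    intro M
    induction M with
    | zero => simp
    | succ M ih =>
      have h : 1 / (x - ((M : ℂ) + 1)) = -(1 / ((M : ℂ) + 1 - x)) := by
        rw [← neg_sub, div_neg]
      rw [Finset.sum_range_succ, Finset.sum_range_succ, ih, cotTerm, h]
      push_cast
      ring
  simp_rw [key]
  have h0 : Tendsto (fun M : ℕ => 1 / ((M : ℂ) + x)) atTop (𝓝 0) := by
    simp_rw [one_div]
    exact tendsto_inv₀_cobounded.comp
      ((tendsto_add_const_cobounded x).comp tendsto_natCast_atTop_cobounded)
  simpa using ((tendsto_logDeriv_euler_cot_sub hx).const_add (1 / x)).sub h0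

open Filter Topology in
/-- A sequence with increments tending to zero which converges along the multiples of `k`
converges. -/
theorem tendsto_of_tendsto_comp_mul {k : ℕ} (hk : 0 < k) {u : ℕ → ℂ} {L : ℂ}
    (h : Tendsto (fun M => u (k * M)) atTop (𝓝 L))
    (hd : Tendsto (fun n => u (n + 1) - u n) atTop (𝓝 0)) : Tendsto u atTop (𝓝 L) := by
  have hmul : Tendsto (fun M => k * M) atTop atTop := tendsto_id.const_mul_atTop' hk
  have hj : ∀ j, Tendsto (fun M => u (k * M + j)) atTop (𝓝 L) := by
    intro j
    induction j with
    | zero => simpa using h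
    | succ j ih =>
      have := ih.add (hd.comp (tendsto_atTop_mono (fun _ => Nat.le_add_right _ j) hmul))
      simpa only [Function.comp_def, add_sub_cancel, add_zero, add_assoc] using this
  refine tendsto_def.2 fun s hs => ?_
  have hall : ∀ᶠ M in atTop, ∀ j ∈ Finset.range k, u (k * M + j) ∈ s :=
    (eventually_all_finset _).2 fun j _ => (hj j).eventually hs
  filter_upwards [(Nat.tendsto_div_const_atTop hk.ne').eventually hall] with N hN
  have := hN (N % k) (Finset.mem_range.2 (Nat.mod_lt _ hk))
  rwa [Nat.div_add_mod] at this

theorem Finset.sum_range_mul_eq_sum_sum {M : Type*} [AddCommMonoid M] (g : ℕ → M) (k n : ℕ) :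
    ∑ i ∈ Finset.range (k * n), g i =
      ∑ q ∈ Finset.range n, ∑ r ∈ Finset.range k, g (k * q + r) := by
  induction n with
  | zero => simp
  | succ n ih => rw [mul_add_one, Finset.sum_range_add, ih, Finset.sum_range_succ]

theorem Finset.sum_Icc_one_reflect {M : Type*} [AddCommMonoid M] (g : ℕ → M) (k : ℕ) :
    ∑ r ∈ Finset.Icc 1 (k - 1), g (k - r) = ∑ r ∈ Finset.Icc 1 (k - 1), g r := by
  refine Finset.sum_nbij' (k - ·) (k - ·) ?_ ?_ ?_ ?_ ?_ <;> intro a ha <;>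
    simp only [Finset.mem_Icc] at * <;> omega

theorem Finset.sum_range_eq_sum_Icc {M : Type*} [AddCommMonoid M] {g : ℕ → M} (hg : g 0 = 0)
    {k : ℕ} (hk : 0 < k) :
    ∑ r ∈ Finset.range k, g r = ∑ r ∈ Finset.Icc 1 (k - 1), g r := by
  symm
  refine Finset.sum_subset (fun r hr => ?_) fun r hr hr' => ?_
  · simp only [Finset.mem_Icc, Finset.mem_range] at *; omega
  · simp only [Finset.mem_Icc, Finset.mem_range] at *
    obtain rfl : r = 0 := by omega
    exact hg

/-- The first moment of a nontrivial root of unity. -/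
theorem sum_range_mul_pow_of_pow_eq_one {k : ℕ} {z : ℂ} (hz : z ^ k = 1) (hz1 : z ≠ 1) :
    ∑ n ∈ Finset.range k, (n : ℂ) * z ^ n = k / (z - 1) := by
  have key : ∀ m : ℕ, (∑ n ∈ Finset.range m, (n : ℂ) * z ^ n) * (z - 1) =
      m * z ^ m - z * ∑ n ∈ Finset.range m, z ^ n := by
    intro m
    induction m with
    | zero => simp
    | succ m ih =>
      rw [Finset.sum_range_succ, Finset.sum_range_succ, add_mul, ih]
      push_cast
      ring
  have hne : z - 1 ≠ 0 := sub_ne_zero.2 hz1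
  rw [eq_div_iff hne, key, geom_sum_eq hz1, hz]
  simp

section OddPeriodic

variable {k : ℕ} {f : ℤ → ℂ}

theorem apply_sub_natCast_of_odd (hper : ∀ n, f (n + k) = f n) (hodd : ∀ n, f (-n) = -f n)
    {r : ℕ} (hr : r ≤ k) : f ((k - r : ℕ) : ℤ) = -f r := by
  rw [← hodd, ← hper (-(r : ℤ)), Nat.cast_sub hr]
  congr 1
  ring

theorem apply_mul_add (hper : ∀ n, f (n + k) = f n) (q r : ℕ) :
    f ((k * q + r : ℕ) : ℤ) = f r := by
  have h := Function.Periodic.nat_mul (f := f) (c := (k : ℤ)) hper q r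
  rw [← h]
  push_cast
  congr 1
  ring

theorem apply_zero_of_odd (hodd : ∀ n, f (-n) = -f n) : f 0 = 0 := by
  have := hodd 0
  rw [neg_zero] at this
  exact self_eq_neg.1 this

theorem natCast_div_mem_integerComplement {r k : ℕ} (hr : 0 < r) (hrk : r < k) :
    (r : ℂ) / k ∈ Complex.integerComplement := by
  rintro ⟨m, hm⟩
  have hk : (k : ℂ) ≠ 0 := by exact_mod_cast (by omega : k ≠ 0)
  rw [eq_div_iff hk] at hm
  have hm' : m * (k : ℤ) = r := by exact_mod_cast hm
  have h0 : 0 < m := by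
    by_contra! h
    nlinarith
  nlinarith

open Filter Topology in
theorem tendsto_apply_div (hk : 0 < k) (hper : ∀ n, f (n + k) = f n) :
    Tendsto (fun n : ℕ => f n / (n : ℂ)) atTop (𝓝 0) := by
  have hb : ∀ n : ℕ, ‖f n‖ ≤ ∑ r ∈ Finset.range k, ‖f r‖ := by
    intro n
    rw [← Nat.div_add_mod n k, apply_mul_add hper]
    exact Finset.single_le_sum (f := fun r : ℕ => ‖f r‖) (fun _ _ => norm_nonneg _)
      (Finset.mem_range.2 (Nat.mod_lt n hk))
  refine squeeze_zero_norm (fun n => ?_)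
    (tendsto_const_div_atTop_nhds_zero_nat (∑ r ∈ Finset.range k, ‖f r‖))
  rw [norm_div, Complex.norm_natCast]
  exact div_le_div_of_nonneg_right (hb n) n.cast_nonneg

theorem sum_period_div (hk : 0 < k) (hper : ∀ n, f (n + k) = f n)
    (hodd : ∀ n, f (-n) = -f n) (q : ℕ) :
    ∑ r ∈ Finset.range k, f ((k * q + r : ℕ) : ℤ) / ((k * q + r : ℕ) : ℂ) =
      1 / (2 * k) * ∑ r ∈ Finset.Icc 1 (k - 1),
        f r * (1 / ((q : ℂ) + r / k) - 1 / ((q : ℂ) + 1 - r / k)) := by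
  have hk0 : (k : ℂ) ≠ 0 := by exact_mod_cast hk.ne'
  simp_rw [apply_mul_add hper]
  rw [Finset.sum_range_eq_sum_Icc (by simp [apply_zero_of_odd hodd]) hk]
  set S := ∑ r ∈ Finset.Icc 1 (k - 1), f r / ((k * q + r : ℕ) : ℂ) with hS
  have hS' : S = ∑ r ∈ Finset.Icc 1 (k - 1), -f r / ((k * q + (k - r) : ℕ) : ℂ) := by
    rw [hS, ← Finset.sum_Icc_one_reflect]
    refine Finset.sum_congr rfl fun r hr => ?_
    rw [apply_sub_natCast_of_odd hper hodd (by simp at hr; omega)]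
  have h2 : 2 * S = 1 / k * ∑ r ∈ Finset.Icc 1 (k - 1),
      f r * (1 / ((q : ℂ) + r / k) - 1 / ((q : ℂ) + 1 - r / k)) := by
    rw [two_mul]
    nth_rewrite 1 [hS]
    rw [hS', ← Finset.sum_add_distrib, Finset.mul_sum]
    refine Finset.sum_congr rfl fun r hr => ?_
    have e1 : ((k * q + r : ℕ) : ℂ) = k * ((q : ℂ) + r / k) := by
      push_cast
      field_simp
    have e2 : ((k * q + (k - r) : ℕ) : ℂ) = k * ((q : ℂ) + 1 - r / k) := by
      rw [Nat.cast_add, Nat.cast_sub (by simp at hr; omega)]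
      push_cast
      field_simp
      ring
    rw [e1, e2, ← div_div, ← div_div]
    ring
  linear_combination h2 / 2

open Filter Topology in
theorem tendsto_sum_apply_div_of_odd (hk : 0 < k) (hper : ∀ n, f (n + k) = f n)
    (hodd : ∀ n, f (-n) = -f n) :
    Tendsto (fun N => ∑ n ∈ Finset.range N, f n / (n : ℂ)) atTop
      (𝓝 (((Real.pi : ℂ) / (2 * k)) *
        ∑ r ∈ Finset.Icc 1 (k - 1), f r * Complex.cot (Real.pi * (r / k)))) := by
  refine tendsto_of_tendsto_comp_mul hk ?_ ?_
  · simp_rw [Finset.sum_range_mul_eq_sum_sum, sum_period_div hk hper hodd, ← Finset.mul_sum]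
    have e : ((Real.pi : ℂ) / (2 * k)) *
        ∑ r ∈ Finset.Icc 1 (k - 1), f r * Complex.cot (Real.pi * (r / k)) =
        1 / (2 * k) * ∑ r ∈ Finset.Icc 1 (k - 1),
          f r * (Real.pi * Complex.cot (Real.pi * (r / k))) := by
      rw [Finset.mul_sum, Finset.mul_sum]
      exact Finset.sum_congr rfl fun r _ => by ring
    rw [e]
    refine Tendsto.const_mul _ ?_
    simp_rw [Finset.sum_comm (s := Finset.range _), ← Finset.mul_sum]
    refine tendsto_finsetSum _ fun r hr => Tendsto.const_mul _ ?_
    rw [Finset.mem_Icc] at hr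
    exact tendsto_sum_inv_sub_inv_reflect
      (natCast_div_mem_integerComplement (by omega) (by omega))
  · simp_rw [Finset.sum_range_succ, add_sub_cancel_left]
    exact tendsto_apply_div hk hper

open Complex in
theorem sum_range_mul_exp {r k : ℕ} (hr : 0 < r) (hrk : r < k) :
    ∑ n ∈ Finset.range k, (n : ℂ) * exp (-(2 * (Real.pi : ℂ) * I * r * n) / k) =
      k * (I / 2 * cot (Real.pi * (r / k)) - 1 / 2) := by
  have hk0 : (k : ℂ) ≠ 0 := by exact_mod_cast (by omega : k ≠ 0)
  have hx := natCast_div_mem_integerComplement hr hrk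
  set t : ℂ := Real.pi * (r / k) with ht
  have hsin : sin t ≠ 0 := sin_pi_mul_ne_zero hx
  set z : ℂ := exp (-(2 * I * t)) with hz
  have hz' : z - 1 = -2 * I * sin t * exp (-t * I) := by
    rw [hz, show -(2 * I * t) = -t * I + -t * I by ring, exp_add, sin]
    have h1 : exp (-t * I) * exp (t * I) = 1 := by rw [← exp_add]; simp
    linear_combination h1 +
      (exp (-t * I) ^ 2 - exp (-t * I) * exp (t * I)) * I_sq
  have hz1 : z ≠ 1 := by
    rw [← sub_ne_zero, hz']
    simp [hsin]
  have hzk : z ^ k = 1 := by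
    rw [hz, ← exp_nat_mul, ht, exp_eq_one_iff]
    refine ⟨-r, ?_⟩
    push_cast
    field_simp
  have hpow : ∀ n : ℕ, exp (-(2 * (Real.pi : ℂ) * I * r * n) / k) = z ^ n := by
    intro n
    rw [hz, ← exp_nat_mul, ht]
    congr 1
    field_simp
  simp_rw [hpow]
  rw [sum_range_mul_pow_of_pow_eq_one hzk hz1, div_eq_mul_inv]
  congr 1
  refine inv_eq_of_mul_eq_one_right ?_
  rw [hz', cot]
  have h2 : (cos t + sin t * I) * exp (-t * I) = 1 := by
    rw [← exp_mul_I, ← exp_add]; simp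
  generalize exp (-t * I) = w at h2 ⊢
  field_simp
  linear_combination h2 - w * cos t * I_sq

theorem sum_Icc_eq_zero_of_odd (hper : ∀ n, f (n + k) = f n) (hodd : ∀ n, f (-n) = -f n) :
    ∑ r ∈ Finset.Icc 1 (k - 1), f r = 0 := by
  refine self_eq_neg.1 ?_
  nth_rewrite 1 [← Finset.sum_Icc_one_reflect]
  rw [← Finset.sum_neg_distrib]
  refine Finset.sum_congr rfl fun r hr => apply_sub_natCast_of_odd hper hodd ?_
  rw [Finset.mem_Icc] at hr
  omega

theorem sum_mul_dft_of_odd (hk : 0 < k) (hper : ∀ n, f (n + k) = f n)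
    (hodd : ∀ n, f (-n) = -f n) :
    ∑ n ∈ Finset.Icc 1 (k - 1), (n : ℂ) * dft k f n =
      k * Complex.I / 2 *
        ∑ r ∈ Finset.Icc 1 (k - 1), f r * Complex.cot (Real.pi * (r / k)) := by
  have h : ∀ r ∈ Finset.Icc 1 (k - 1), f r * ∑ n ∈ Finset.range k,
      (n : ℂ) * Complex.exp (-(2 * (Real.pi : ℂ) * Complex.I * r * n) / k) =
      k * Complex.I / 2 * (f r * Complex.cot (Real.pi * (r / k))) - k / 2 * f r := by
    intro r hr
    rw [Finset.mem_Icc] at hr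
    rw [sum_range_mul_exp (by omega) (by omega)]
    ring
  rw [← Finset.sum_range_eq_sum_Icc (g := fun n : ℕ => (n : ℂ) * dft k f n) (by simp) hk]
  simp_rw [dft, Finset.mul_sum]
  rw [Finset.sum_comm, Finset.sum_range_eq_sum_Icc (by simp [apply_zero_of_odd hodd]) hk,
    ← sub_zero (∑ r ∈ Finset.Icc 1 (k - 1), _ * _),
    ← mul_zero ((k : ℂ) / 2), ← sum_Icc_eq_zero_of_odd hper hodd, Finset.mul_sum,
    ← Finset.sum_sub_distrib]
  refine Finset.sum_congr rfl fun r hr => ?_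
  rw [← h r hr, Finset.mul_sum]
  refine Finset.sum_congr rfl fun n _ => ?_
  push_cast
  ring

end OddPeriodic

theorem series_of_odd_periodic (k : ℕ) (hk : 0 < k) (f : ℤ → ℂ)
    (hper : ∀ n, f (n + k) = f n) (hodd : ∀ n, f (-n) = -f n) :
    Filter.Tendsto (fun N => ∑ r ∈ Finset.range N, f (r + 1) / ((r : ℂ) + 1)) Filter.atTop
        (nhds (((Real.pi : ℂ) / (2 * k)) *
          ∑ r ∈ Finset.Icc 1 (k - 1),
            f r * ((Real.cos (Real.pi * r / k) / Real.sin (Real.pi * r / k) : ℝ) : ℂ))) ∧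
      ((Real.pi : ℂ) / (2 * k)) *
          ∑ r ∈ Finset.Icc 1 (k - 1),
            f r * ((Real.cos (Real.pi * r / k) / Real.sin (Real.pi * r / k) : ℝ) : ℂ)
        = -((Real.pi : ℂ) * Complex.I / (k : ℂ) ^ 2) *
            ∑ r ∈ Finset.Icc 1 (k - 1), (r : ℂ) * dft k f r := by
  have hcot : ∀ r : ℕ, ((Real.cos (Real.pi * r / k) / Real.sin (Real.pi * r / k) : ℝ) : ℂ) =
      Complex.cot (Real.pi * (r / k)) := by
    intro r
    rw [Complex.cot]
    push_cast
    rw [mul_div_assoc]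
  simp_rw [hcot]
  constructor
  · refine ((Filter.tendsto_add_atTop_iff_nat 1).2
      (tendsto_sum_apply_div_of_odd hk hper hodd)).congr fun N => ?_
    rw [Finset.sum_range_succ']
    simp
  · have hk0 : (k : ℂ) ≠ 0 := by exact_mod_cast hk.ne'
    rw [sum_mul_dft_of_odd hk hper hodd]
    field_simp
    simp
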